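/- Let T be a tree of order 10 that is not isomorphic to K_2 ∗ 4K_2. Then d(T) ≤ 556, and equality holds if and only if T is isomorphic to K_1 ∗ (3K_1 ∪ 3K_2). -/

import Mathlib

open SimpleGraph

/-- `S` is a dissociation set of `G`: every vertex of `S` has at most one neighbor in `S`. -/
def IsDissociation {V : Type*} (G : SimpleGraph V) (S : Set V) : Prop :=
  ∀ v ∈ S, (G.neighborSet v ∩ S).Subsingleton

/-- `d(G)`: the number of dissociation sets of `G`. -/
noncomputable def dissocNum {V : Type*} (G : SimpleGraph V) : ℕ :=
  Nat.card {S : Set V // IsDissociation G S}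

/-- `K_{r+1} ∗ (K_{s₀+1} ∪ ⋯ ∪ K_{sₜ+1})`: the hub `Sum.inl 0` of the complete graph
`K_{r+1}` is joined to the vertex `0` of each complete component. -/
def starGraph (r : ℕ) (s : List ℕ) :
    SimpleGraph (Fin (r + 1) ⊕ (Σ i : Fin s.length, Fin (s.get i + 1))) where
  Adj x y := x ≠ y ∧
    (Sum.elim (fun _ => (none : Option (Fin s.length))) (fun p => some p.1) x =
        Sum.elim (fun _ => (none : Option (Fin s.length))) (fun p => some p.1) y ∨
      (x = Sum.inl 0 ∧ ∃ i, y = Sum.inr ⟨i, 0⟩) ∨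
      (y = Sum.inl 0 ∧ ∃ i, x = Sum.inr ⟨i, 0⟩))
  symm := by
    constructor
    rintro x y ⟨h1, h2⟩
    refine ⟨h1.symm, ?_⟩
    rcases h2 with h | h | h
    · exact Or.inl h.symm
    · exact Or.inr (Or.inr h)
    · exact Or.inr (Or.inl h)
  loopless := ⟨fun x h => h.1 rfl⟩

/-- Two disjoint graphs joined by the single edge `u — w`. -/
def edgeJoin {V W : Type*} (G : SimpleGraph V) (u : V) (H : SimpleGraph W) (w : W) :
    SimpleGraph (V ⊕ W) where
  Adj
    | .inl a, .inl b => G.Adj a b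
    | .inr a, .inr b => H.Adj a b
    | .inl a, .inr b => a = u ∧ b = w
    | .inr b, .inl a => a = u ∧ b = w
  symm := ⟨by
    rintro (a | a) (b | b) h
    exacts [G.adj_symm h, h, h, H.adj_symm h]⟩
  loopless := ⟨by
    rintro (a | a) h
    exacts [G.irrefl h, H.irrefl h]⟩

section edgeJoin

variable {V W X V' W' : Type*} {G : SimpleGraph V} {H : SimpleGraph W}
  {G' : SimpleGraph V'} {H' : SimpleGraph W'}

@[simp] theorem edgeJoin_inl_inl {u : V} {w : W} {a b : V} :
    (edgeJoin G u H w).Adj (.inl a) (.inl b) ↔ G.Adj a b := Iff.rfl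

@[simp] theorem edgeJoin_inr_inr {u : V} {w : W} {a b : W} :
    (edgeJoin G u H w).Adj (.inr a) (.inr b) ↔ H.Adj a b := Iff.rfl

@[simp] theorem edgeJoin_inl_inr {u : V} {w : W} {a : V} {b : W} :
    (edgeJoin G u H w).Adj (.inl a) (.inr b) ↔ a = u ∧ b = w := Iff.rfl

@[simp] theorem edgeJoin_inr_inl {u : V} {w : W} {a : V} {b : W} :
    (edgeJoin G u H w).Adj (.inr b) (.inl a) ↔ a = u ∧ b = w := Iff.rfl

def edgeJoinCongr (e : G ≃g G') (f : H ≃g H') {u : V} {w : W} {u' : V'} {w' : W'}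
    (hu : e u = u') (hw : f w = w') : edgeJoin G u H w ≃g edgeJoin G' u' H' w' where
  toEquiv := Equiv.sumCongr e.toEquiv f.toEquiv
  map_rel_iff' := by
    subst hu hw
    rintro (a | a) (b | b) <;> simp [e.map_adj_iff, f.map_adj_iff]

def edgeJoinComm (G : SimpleGraph V) (u : V) (H : SimpleGraph W) (w : W) :
    edgeJoin G u H w ≃g edgeJoin H w G u where
  toEquiv := Equiv.sumComm V W
  map_rel_iff' := by
    rintro (a | a) (b | b) <;> simp [and_comm]

def edgeJoinAssoc (G : SimpleGraph V) (u : V) (H : SimpleGraph W) (w v : W) (K : SimpleGraph X)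
    (x : X) :
    edgeJoin (edgeJoin G u H w) (.inr v) K x ≃g edgeJoin G u (edgeJoin H v K x) (.inl w) where
  toEquiv := Equiv.sumAssoc V W X
  map_rel_iff' := by
    rintro ((a | a) | a) ((b | b) | b) <;> simp

def edgeJoinRightComm (G : SimpleGraph V) (u v : V) (H : SimpleGraph W) (w : W)
    (K : SimpleGraph X) (x : X) :
    edgeJoin (edgeJoin G u H w) (.inl v) K x ≃g edgeJoin (edgeJoin G v K x) (.inl u) H w where
  toEquiv := (Equiv.sumAssoc V W X).trans <|
    ((Equiv.refl V).sumCongr (Equiv.sumComm W X)).trans (Equiv.sumAssoc V X W).symm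
  map_rel_iff' := by
    rintro ((a | a) | a) ((b | b) | b) <;> simp

theorem isDissociation_edgeJoin {u : V} {w : W} {S : Set (V ⊕ W)} :
    IsDissociation (edgeJoin G u H w) S ↔
      IsDissociation G (Sum.inl ⁻¹' S) ∧ IsDissociation H (Sum.inr ⁻¹' S) ∧
        (.inl u ∈ S → .inr w ∈ S →
          (∀ a, .inl a ∈ S → ¬ G.Adj u a) ∧ ∀ b, .inr b ∈ S → ¬ H.Adj w b) := by
  constructor
  · intro h
    refine ⟨fun v hv a ha b hb => ?_, fun v hv a ha b hb => ?_, fun hu hw =>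
      ⟨fun a ha hua => ?_, fun b hb hwb => ?_⟩⟩
    · exact Sum.inl_injective (@h (.inl v) hv (.inl a) ha (.inl b) hb)
    · exact Sum.inr_injective (@h (.inr v) hv (.inr a) ha (.inr b) hb)
    · exact Sum.inl_ne_inr (@h (.inl u) hu (.inl a) ⟨hua, ha⟩ (.inr w) ⟨⟨rfl, rfl⟩, hw⟩)
    · exact Sum.inl_ne_inr (@h (.inr w) hw (.inl u) ⟨⟨rfl, rfl⟩, hu⟩ (.inr b) ⟨hwb, hb⟩)
  · rintro ⟨hG, hH, huw⟩ (v | v) hv (a | a) ⟨hva, ha⟩ (b | b) ⟨hvb, hb⟩ <;>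
      simp only [mem_neighborSet, edgeJoin_inl_inl, edgeJoin_inl_inr, edgeJoin_inr_inl,
        edgeJoin_inr_inr] at hva hvb
    · exact congrArg _ (hG v hv ⟨hva, ha⟩ ⟨hvb, hb⟩)
    · obtain ⟨rfl, rfl⟩ := hvb
      exact absurd hva ((huw hv hb).1 a ha)
    · obtain ⟨rfl, rfl⟩ := hva
      exact absurd hvb ((huw hv ha).1 b hb)
    · rw [hva.2, hvb.2]
    · rw [hva.1, hvb.1]
    · obtain ⟨rfl, rfl⟩ := hva
      exact absurd hvb ((huw ha hv).2 b hb)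
    · obtain ⟨rfl, rfl⟩ := hvb
      exact absurd hva ((huw hb hv).2 a ha)
    · exact congrArg _ (hH v hv ⟨hva, ha⟩ ⟨hvb, hb⟩)

end edgeJoin

section counting

variable {V W : Type*}

theorem card_subtype_preimage_inl_inr (P : Set V → Prop) (Q : Set W → Prop) :
    Nat.card {S : Set (V ⊕ W) // P (Sum.inl ⁻¹' S) ∧ Q (Sum.inr ⁻¹' S)} =
      Nat.card {A // P A} * Nat.card {B // Q B} := by
  rw [← Nat.card_prod]
  exact Nat.card_congr (((Equiv.sumArrowEquivProdArrow V W Prop).subtypeEquiv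
    fun _ => Iff.rfl).trans (Equiv.subtypeProdEquivProd (p := P) (q := Q)))

theorem card_subtype_or {α : Type*} [Finite α] {p q : α → Prop} (h : ∀ a, p a → ¬ q a) :
    Nat.card {a // p a ∨ q a} = Nat.card {a // p a} + Nat.card {a // q a} := by
  classical
  rw [← Nat.card_sum]
  exact Nat.card_congr (subtypeOrEquiv p q (Pi.disjoint_iff.2 fun a =>
    Prop.disjoint_iff.2 (by have := h a; tauto)))

/-- Dissociation sets avoiding `r`. -/
def Avoids (G : SimpleGraph V) (r : V) (S : Set V) : Prop :=
  IsDissociation G S ∧ r ∉ S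

/-- Dissociation sets in which `r` is an isolated vertex. -/
def Isolates (G : SimpleGraph V) (r : V) (S : Set V) : Prop :=
  IsDissociation G S ∧ r ∈ S ∧ ∀ a ∈ S, ¬ G.Adj r a

/-- Dissociation sets in which `r` has a neighbor. -/
def Matches (G : SimpleGraph V) (r : V) (S : Set V) : Prop :=
  IsDissociation G S ∧ r ∈ S ∧ ∃ a ∈ S, G.Adj r a

theorem dissocNum_eq_add [Finite V] (G : SimpleGraph V) (r : V) :
    dissocNum G = Nat.card {S // Avoids G r S} + Nat.card {S // Isolates G r S} +
      Nat.card {S // Matches G r S} := by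
  rw [← card_subtype_or fun S h h' => h.2 h'.2.1, ← card_subtype_or, dissocNum]
  · refine Nat.card_congr (Equiv.subtypeEquivRight fun S => ?_)
    simp only [Avoids, Isolates, Matches]
    grind
  · rintro S (h | h) ⟨h₁, h₂, a, ha, hra⟩
    exacts [h.2 h₂, h.2.2 a ha hra]

variable {G : SimpleGraph V} {H : SimpleGraph W} {u : V} {w : W}

theorem card_avoids_edgeJoin :
    Nat.card {S // Avoids (edgeJoin G u H w) (.inl u) S} =
      Nat.card {S // Avoids G u S} * dissocNum H := by
  rw [dissocNum, ← card_subtype_preimage_inl_inr]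
  refine Nat.card_congr (Equiv.subtypeEquivRight fun S => ?_)
  simp only [Avoids, isDissociation_edgeJoin, Set.mem_preimage]
  tauto

theorem card_isolates_edgeJoin :
    Nat.card {S // Isolates (edgeJoin G u H w) (.inl u) S} =
      Nat.card {S // Isolates G u S} * Nat.card {S // Avoids H w S} := by
  rw [← card_subtype_preimage_inl_inr]
  refine Nat.card_congr (Equiv.subtypeEquivRight fun S => ?_)
  simp only [Avoids, Isolates, isDissociation_edgeJoin, Set.mem_preimage, Sum.forall,
    edgeJoin_inl_inl, edgeJoin_inl_inr]
  grind

theorem card_matches_edgeJoin [Finite V] [Finite W] :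
    Nat.card {S // Matches (edgeJoin G u H w) (.inl u) S} =
      Nat.card {S // Matches G u S} * Nat.card {S // Avoids H w S} +
        Nat.card {S // Isolates G u S} * Nat.card {S // Isolates H w S} := by
  rw [← card_subtype_preimage_inl_inr, ← card_subtype_preimage_inl_inr, ← card_subtype_or]
  · refine Nat.card_congr (Equiv.subtypeEquivRight fun S => ?_)
    simp only [Avoids, Isolates, Matches, isDissociation_edgeJoin, Set.mem_preimage,
      Sum.exists, edgeJoin_inl_inl, edgeJoin_inl_inr]
    grind
  · rintro S ⟨-, h⟩ ⟨-, h'⟩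
    exact h.2 h'.2.1

theorem IsDissociation.preimage {S : Set W} (h : IsDissociation H S) (e : G ≃g H) :
    IsDissociation G (e ⁻¹' S) := fun v hv _ ha _ hb =>
  e.injective (h (e v) hv ⟨e.map_adj_iff.2 ha.1, ha.2⟩ ⟨e.map_adj_iff.2 hb.1, hb.2⟩)

theorem dissocNum_congr (e : G ≃g H) : dissocNum G = dissocNum H := by
  refine Nat.card_congr ((e.toEquiv.arrowCongr (Equiv.refl Prop)).subtypeEquiv fun (S : Set V) =>
    ⟨fun h => h.preimage e.symm, fun h => ?_⟩)
  have h' : IsDissociation G (e ⁻¹' (e.symm ⁻¹' S)) := IsDissociation.preimage h e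
  rwa [show e ⁻¹' (e.symm ⁻¹' S) = S from Set.ext fun v => by simp] at h'

theorem counts_of_unique [Unique V] (G : SimpleGraph V) (r : V) :
    (Nat.card {S // Avoids G r S}, Nat.card {S // Isolates G r S}, Nat.card {S // Matches G r S}) =
      (1, 1, 0) := by
  have hG (S : Set V) : IsDissociation G S := fun _ _ _ _ _ _ => Subsingleton.elim _ _
  have hadj (a : V) : ¬ G.Adj r a := Subsingleton.elim r a ▸ G.irrefl
  refine Prod.ext ?_ (Prod.ext ?_ ?_)
  · have (S : Set V) : Avoids G r S ↔ S = ∅ := by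
      simp only [Avoids, hG, true_and, Set.eq_empty_iff_forall_notMem]
      exact ⟨fun h a => Subsingleton.elim r a ▸ h, fun h => h r⟩
    simp [this]
  · have (S : Set V) : Isolates G r S ↔ S = Set.univ := by
      simp only [Isolates, hG, hadj, true_and, Set.eq_univ_iff_forall]
      exact ⟨fun h a => Subsingleton.elim r a ▸ h.1, fun h => ⟨h r, by simp⟩⟩
    simp [this]
  · simp [Matches, hadj]

end counting

/-- Rooted plane trees: `join t s` attaches the root of `s` as the last child of the root
of `t`. -/
inductive JoinTree : Type
  | leaf : JoinTree
  | join : JoinTree → JoinTree → JoinTree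

namespace JoinTree

instance decEq : DecidableEq JoinTree
  | leaf, leaf => isTrue rfl
  | leaf, join _ _ => isFalse nofun
  | join _ _, leaf => isFalse nofun
  | join t s, join t' s' =>
    have := decEq t t'
    have := decEq s s'
    decidable_of_iff (t = t' ∧ s = s') (by simp)

/-- The vertices of a rooted plane tree. -/
def Vert : JoinTree → Type
  | leaf => Unit
  | join t s => t.Vert ⊕ s.Vert

def root : (t : JoinTree) → t.Vert
  | leaf => ()
  | join t _ => .inl t.root

def graph : (t : JoinTree) → SimpleGraph t.Vert
  | leaf => (⊥ : SimpleGraph Unit)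
  | join t s => edgeJoin t.graph t.root s.graph s.root

def size : JoinTree → ℕ
  | leaf => 1
  | join t s => t.size + s.size

instance : (t : JoinTree) → Fintype t.Vert
  | leaf => inferInstanceAs (Fintype Unit)
  | join t s =>
    have := instFintypeVert t
    have := instFintypeVert s
    inferInstanceAs (Fintype (t.Vert ⊕ s.Vert))

theorem card_vert : (t : JoinTree) → Nat.card t.Vert = t.size
  | leaf => Nat.card_unique (α := Unit)
  | join t s => by
    rw [size, ← card_vert t, ← card_vert s]
    exact Nat.card_sum

/-- The numbers of dissociation sets avoiding the root, isolating the root, and matching the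
root with a neighbor. -/
def counts : JoinTree → ℕ × ℕ × ℕ
  | leaf => (1, 1, 0)
  | join t s =>
    let (a, b, c) := t.counts
    let (a', b', c') := s.counts
    (a * (a' + b' + c'), b * a', c * a' + b * b')

def total (t : JoinTree) : ℕ := t.counts.1 + t.counts.2.1 + t.counts.2.2

theorem counts_eq (t : JoinTree) :
    t.counts = (Nat.card {S // Avoids t.graph t.root S},
      Nat.card {S // Isolates t.graph t.root S}, Nat.card {S // Matches t.graph t.root S}) := by
  induction t with
  | leaf => exact (counts_of_unique (V := Unit) ⊥ ()).symm
  | join t s iht ihs =>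
    refine Prod.ext ?_ (Prod.ext ?_ ?_)
    · exact (by simp [counts, iht, ihs, dissocNum_eq_add s.graph s.root] :
        (join t s).counts.1 = _).trans card_avoids_edgeJoin.symm
    · exact (by simp [counts, iht, ihs] : (join t s).counts.2.1 = _).trans
        card_isolates_edgeJoin.symm
    · exact (by simp [counts, iht, ihs] : (join t s).counts.2.2 = _).trans
        card_matches_edgeJoin.symm

theorem dissocNum_graph (t : JoinTree) : dissocNum t.graph = t.total := by
  rw [dissocNum_eq_add t.graph t.root, total, counts_eq]

/-- Any vertex of a rooted plane tree can receive a further plane tree, up to isomorphism. -/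
theorem exists_edgeJoin_iso (k t : JoinTree) (u : t.Vert) :
    ∃ (s : JoinTree) (e : edgeJoin t.graph u k.graph k.root ≃g s.graph),
      e (.inl t.root) = s.root := by
  induction t with
  | leaf => exact ⟨join leaf k, Iso.refl, rfl⟩
  | join t s iht ihs =>
    obtain u | u := u
    · obtain ⟨y, e, he⟩ := iht u
      exact ⟨join y s, (edgeJoinRightComm _ _ _ _ _ _ _).trans (edgeJoinCongr e .refl he rfl),
        congrArg Sum.inl he⟩
    · obtain ⟨y, e, he⟩ := ihs u
      refine ⟨join t y, (edgeJoinAssoc _ _ _ _ _ _ _).trans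
        (edgeJoinCongr .refl e rfl he), rfl⟩

theorem exists_iso_of_isTree {V : Type*} [Finite V] {T : SimpleGraph V} (hT : T.IsTree) :
    ∃ t : JoinTree, Nonempty (T ≃g t.graph) := by
  induction h : Nat.card V using Nat.strong_induction_on generalizing V with
  | _ n ih =>
  classical
  have := Fintype.ofFinite V
  cases subsingleton_or_nontrivial V with
  | inl _ =>
    have := hT.connected.nonempty
    obtain ⟨v⟩ := this
    have := uniqueOfSubsingleton v
    exact ⟨leaf, ⟨⟨Equiv.ofUnique V Unit, by
      intro a b
      rw [Subsingleton.elim a b]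
      simp⟩⟩⟩
  | inr _ =>
    obtain ⟨v, hv⟩ := hT.exists_vert_degree_one_of_nontrivial
    have hS : (T.induce {v}ᶜ).IsTree :=
      ⟨hT.connected.induce_compl_singleton_of_degree_eq_one hv, hT.isAcyclic.induce _⟩
    obtain ⟨u, huv, hu⟩ := degree_eq_one_iff_existsUnique_adj.1 hv
    obtain ⟨t, ⟨e⟩⟩ := ih _ (by rw [← h]; exact Finite.card_subtype_lt (x := v) (by simp)) hS rfl
    obtain ⟨s, f, -⟩ := exists_edgeJoin_iso leaf t (e ⟨u, huv.ne'⟩)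
    let g : edgeJoin (T.induce {v}ᶜ) ⟨u, huv.ne'⟩ leaf.graph leaf.root ≃g T :=
      { toEquiv := Equiv.ofBijective (Sum.elim Subtype.val fun _ => v) (by
          refine ⟨?_, fun a => ?_⟩
          · rintro (⟨a, ha⟩ | a) (⟨b, hb⟩ | b) hab
            · exact congrArg _ (Subtype.ext hab)
            · exact absurd hab ha
            · exact absurd hab.symm hb
            · rfl
          · by_cases ha : a = v
            exacts [⟨.inr (), ha.symm⟩, ⟨.inl ⟨a, ha⟩, rfl⟩])
        map_rel_iff' := by
          have hvu (a : V) : T.Adj v a ↔ a = u := ⟨hu a, fun h => h ▸ huv⟩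
          rintro (⟨a, ha⟩ | a) (⟨b, hb⟩ | b)
          · exact Iff.rfl
          · exact (T.adj_comm _ _).trans ((hvu a).trans
              ⟨fun h => ⟨Subtype.ext h, rfl⟩, fun h => congrArg Subtype.val h.1⟩)
          · exact (hvu b).trans
              ⟨fun h => ⟨Subtype.ext h, rfl⟩, fun h => congrArg Subtype.val h.1⟩
          · exact iff_of_false T.irrefl (SimpleGraph.irrefl _) }
    exact ⟨s, ⟨g.symm.trans ((edgeJoinCongr e .refl rfl rfl).trans f)⟩⟩

/-- Plane trees that represent the same rooted tree. -/
def RootedIso (t s : JoinTree) : Prop := ∃ e : t.graph ≃g s.graph, e t.root = s.root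

namespace RootedIso

theorem refl (t : JoinTree) : RootedIso t t := ⟨Iso.refl, rfl⟩

variable {t t' s s' k : JoinTree}

theorem trans : RootedIso t s → RootedIso s k → RootedIso t k
  | ⟨e, he⟩, ⟨f, hf⟩ => ⟨e.trans f, (congrArg f he).trans hf⟩

theorem join : RootedIso t t' → RootedIso s s' → RootedIso (t.join s) (t'.join s')
  | ⟨e, he⟩, ⟨f, hf⟩ => ⟨edgeJoinCongr e f he hf, congrArg Sum.inl he⟩

theorem join_right_comm (t s k : JoinTree) :
    RootedIso ((t.join s).join k) ((t.join k).join s) :=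
  ⟨edgeJoinRightComm _ _ _ _ _ _ _, rfl⟩

end RootedIso

/-- Insert `s` among the children of the root of `t` ordered by size. -/
def insertChild : JoinTree → JoinTree → JoinTree
  | leaf, s => join leaf s
  | join t k, s => if k.size ≤ s.size then join (join t k) s else join (insertChild t s) k

theorem rootedIso_insertChild : (t s : JoinTree) → RootedIso (join t s) (insertChild t s)
  | leaf, s => .refl _
  | join t k, s => by
    unfold insertChild
    split
    · exact .refl _
    · exact (RootedIso.join_right_comm t k s).trans ((rootedIso_insertChild t s).join (.refl k))

/-- Sort the children of every vertex by size. -/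
def sort : JoinTree → JoinTree
  | leaf => leaf
  | join t s => insertChild t.sort s.sort

theorem rootedIso_sort : (t : JoinTree) → RootedIso t t.sort
  | leaf => .refl _
  | join t s => ((rootedIso_sort t).join (rootedIso_sort s)).trans (rootedIso_insertChild _ _)

/-- Move the root to its last child. -/
def reroot : JoinTree → JoinTree
  | leaf => leaf
  | join t s => join s t

theorem nonempty_iso_reroot : (t : JoinTree) → Nonempty (t.graph ≃g t.reroot.graph)
  | leaf => ⟨.refl⟩
  | join _ _ => ⟨edgeJoinComm _ _ _ _⟩

theorem nonempty_iso_sort_reroot (t : JoinTree) :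
    Nonempty (t.graph ≃g t.reroot.sort.graph) :=
  let ⟨e⟩ := nonempty_iso_reroot t
  let ⟨f, _⟩ := rootedIso_sort t.reroot
  ⟨e.trans f⟩

/-- The size of the last child of the root. -/
def lastSize : JoinTree → ℕ
  | leaf => 0
  | join _ s => s.size

/-- The children of every vertex are ordered by size. -/
def Sorted : JoinTree → Prop
  | leaf => True
  | join t s => t.Sorted ∧ s.Sorted ∧ t.lastSize ≤ s.size

theorem lastSize_insertChild (t s : JoinTree) :
    (insertChild t s).lastSize = max t.lastSize s.size := by
  cases t with
  | leaf => simp [insertChild, lastSize]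
  | join t k =>
    unfold insertChild
    split <;> simp only [lastSize] <;> lia

theorem Sorted.insertChild {t s : JoinTree} (ht : t.Sorted) (hs : s.Sorted) :
    (insertChild t s).Sorted := by
  induction t with
  | leaf => exact ⟨trivial, hs, Nat.zero_le _⟩
  | join t k iht =>
    unfold JoinTree.insertChild
    split_ifs with h
    · exact ⟨ht, hs, h⟩
    · refine ⟨iht ht.1, ht.2.1, ?_⟩
      rw [lastSize_insertChild]
      exact max_le ht.2.2 (Nat.le_of_not_ge h)

theorem sorted_sort : (t : JoinTree) → t.sort.Sorted
  | leaf => trivial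
  | join t s => (sorted_sort t).insertChild (sorted_sort s)

theorem exists_sorted_iso_of_isTree {V : Type*} [Finite V] {T : SimpleGraph V} (hT : T.IsTree) :
    ∃ t : JoinTree, t.Sorted ∧ Nonempty (T ≃g t.graph) :=
  let ⟨t, ⟨e⟩⟩ := exists_iso_of_isTree hT
  let ⟨f, _⟩ := rootedIso_sort t
  ⟨t.sort, sorted_sort t, ⟨e.trans f⟩⟩

/-- All sorted plane trees with `n` vertices, provided that `n ≤ k`. -/
def enum : ℕ → ℕ → List JoinTree
  | 0, _ => []
  | k + 1, n => if n = 1 then [leaf] else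
    (List.range n).flatMap fun i =>
      ((enum k i).filter fun t => t.lastSize ≤ n - i).flatMap fun t =>
        (enum k (n - i)).map (join t)

theorem size_pos : (t : JoinTree) → 0 < t.size
  | leaf => Nat.one_pos
  | join t _ => Nat.add_pos_left (size_pos t) _

theorem Sorted.mem_enum {t : JoinTree} (ht : t.Sorted) {k : ℕ} (h : t.size ≤ k) :
    t ∈ enum k t.size := by
  induction t generalizing k with
  | leaf =>
    cases k with
    | zero => simp [size] at h
    | succ k => simp [enum, size]
  | join t s iht ihs =>
    have ht₀ := t.size_pos
    have hs₀ := s.size_pos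
    rw [size] at h ⊢
    obtain ⟨k, rfl⟩ := Nat.exists_eq_succ_of_ne_zero (show k ≠ 0 by lia)
    rw [enum, if_neg (by lia)]
    simp only [List.mem_flatMap, List.mem_range, List.mem_map, List.mem_filter]
    refine ⟨t.size, by lia, t, ⟨iht ht.1 (by lia), ?_⟩, s, ?_, rfl⟩
    · rw [Nat.add_sub_cancel_left]
      exact decide_eq_true ht.2.2
    · rw [Nat.add_sub_cancel_left]
      exact ihs ht.2.1 (by lia)

/-- The tree with two vertices. -/
abbrev edge : JoinTree := join leaf leaf

/-- The tree `K₁ ∗ (3K₁ ∪ 3K₂)`, rooted at its hub. -/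
abbrev extremal : JoinTree :=
  ((((((leaf.join leaf).join leaf).join leaf).join edge).join edge).join edge)

/-- The tree `K₂ ∗ 4K₂`, rooted at its hub. -/
abbrev exceptional : JoinTree :=
  (((((leaf.join leaf).join edge).join edge).join edge).join edge)

set_option maxRecDepth 100000 in
theorem enum_ten : (enum 10 10).all (fun t => decide (t.total ≤ 555) ||
    [t, t.reroot.sort, t.reroot.sort.reroot.sort].any
      (fun s => decide (s = extremal) || decide (s = exceptional))) = true := by
  decide +kernel

instance : (t : JoinTree) → DecidableEq t.Vert
  | leaf => inferInstanceAs (DecidableEq Unit)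
  | join t s =>
    have := instDecidableEqVert t
    have := instDecidableEqVert s
    inferInstanceAs (DecidableEq (t.Vert ⊕ s.Vert))

instance : (t : JoinTree) → DecidableRel t.graph.Adj
  | leaf => inferInstanceAs (DecidableRel (⊥ : SimpleGraph Unit).Adj)
  | join t s =>
    have := instDecidableRelVertAdjGraph t
    have := instDecidableRelVertAdjGraph s
    fun a b => match a, b with
      | .inl a, .inl b => inferInstanceAs (Decidable (t.graph.Adj a b))
      | .inr a, .inr b => inferInstanceAs (Decidable (s.graph.Adj a b))
      | .inl a, .inr b => inferInstanceAs (Decidable (a = t.root ∧ b = s.root))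
      | .inr b, .inl a => inferInstanceAs (Decidable (a = t.root ∧ b = s.root))

instance (r : ℕ) (s : List ℕ) : DecidableRel (_root_.starGraph r s).Adj := fun a b =>
  inferInstanceAs (Decidable (a ≠ b ∧ (_ ∨ (_ ∧ ∃ _, b = _) ∨ (_ ∧ ∃ _, a = _))))

theorem nonempty_iso_of_decide {t : JoinTree} {W : Type*} [Fintype W] [DecidableEq W]
    {G : SimpleGraph W} [DecidableRel G.Adj] (f : t.Vert → W)
    (h : decide (f.Bijective ∧ ∀ a b, G.Adj (f a) (f b) ↔ t.graph.Adj a b) = true) :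
    Nonempty (t.graph ≃g G) :=
  have h := of_decide_eq_true h
  ⟨⟨.ofBijective f h.1, h.2 _ _⟩⟩

set_option maxRecDepth 100000 in
theorem nonempty_iso_extremal :
    Nonempty (extremal.graph ≃g _root_.starGraph 0 [0, 0, 0, 1, 1, 1]) :=
  nonempty_iso_of_decide
    (Sum.elim (Sum.elim (Sum.elim (Sum.elim (Sum.elim (Sum.elim
      (fun _ => .inl 0)
      (fun _ => .inr ⟨0, 0⟩))
      (fun _ => .inr ⟨1, 0⟩))
      (fun _ => .inr ⟨2, 0⟩))
      (Sum.elim (fun _ => .inr ⟨3, 0⟩) (fun _ => .inr ⟨3, 1⟩)))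
      (Sum.elim (fun _ => .inr ⟨4, 0⟩) (fun _ => .inr ⟨4, 1⟩)))
      (Sum.elim (fun _ => .inr ⟨5, 0⟩) (fun _ => .inr ⟨5, 1⟩)))
    (by decide +kernel)

set_option maxRecDepth 100000 in
theorem nonempty_iso_exceptional :
    Nonempty (exceptional.graph ≃g _root_.starGraph 1 [1, 1, 1, 1]) :=
  nonempty_iso_of_decide
    (Sum.elim (Sum.elim (Sum.elim (Sum.elim (Sum.elim
      (fun _ => .inl 0)
      (fun _ => .inl 1))
      (Sum.elim (fun _ => .inr ⟨0, 0⟩) (fun _ => .inr ⟨0, 1⟩)))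
      (Sum.elim (fun _ => .inr ⟨1, 0⟩) (fun _ => .inr ⟨1, 1⟩)))
      (Sum.elim (fun _ => .inr ⟨2, 0⟩) (fun _ => .inr ⟨2, 1⟩)))
      (Sum.elim (fun _ => .inr ⟨3, 0⟩) (fun _ => .inr ⟨3, 1⟩)))
    (by decide +kernel)

theorem Sorted.total_le_or_nonempty_iso {t : JoinTree} (hsort : t.Sorted) (ht : t.size = 10) :
    t.total ≤ 555 ∨ Nonempty (t.graph ≃g extremal.graph) ∨
      Nonempty (t.graph ≃g exceptional.graph) := by
  obtain ⟨e₁⟩ := nonempty_iso_sort_reroot t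
  obtain ⟨e₂⟩ := nonempty_iso_sort_reroot t.reroot.sort
  have h := List.all_eq_true.1 enum_ten t (ht ▸ hsort.mem_enum (k := 10) ht.le)
  simp only [List.any_cons, List.any_nil, Bool.or_eq_true, decide_eq_true_eq, Bool.false_eq_true,
    or_false] at h
  obtain h | (h | h) | (h | h) | (h | h) := h
  · exact .inl h
  · exact .inr (.inl ⟨h ▸ .refl⟩)
  · exact .inr (.inr ⟨h ▸ .refl⟩)
  · exact .inr (.inl ⟨h ▸ e₁⟩)
  · exact .inr (.inr ⟨h ▸ e₁⟩)
  · exact .inr (.inl ⟨h ▸ e₁.trans e₂⟩)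
  · exact .inr (.inr ⟨h ▸ e₁.trans e₂⟩)

end JoinTree

theorem dissocNum_starGraph_extremal : dissocNum (_root_.starGraph 0 [0, 0, 0, 1, 1, 1]) = 556 :=
  let ⟨e⟩ := JoinTree.nonempty_iso_extremal
  (dissocNum_congr e).symm.trans (JoinTree.dissocNum_graph _)

/-- A tree of order 10 other than `K₂ ∗ 4K₂` has at most 556 dissociation sets, with
equality iff it is `K₁ ∗ (3K₁ ∪ 3K₂)`. -/
theorem tree_order_ten {V : Type*} [Fintype V] (T : SimpleGraph V)
    (h10 : Fintype.card V = 10) (hT : T.IsTree)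
    (hnot : ¬ Nonempty (T ≃g starGraph 1 [1, 1, 1, 1])) :
    dissocNum T ≤ 556 ∧
      (dissocNum T = 556 ↔ Nonempty (T ≃g starGraph 0 [0, 0, 0, 1, 1, 1])) := by
  obtain ⟨t, ht₀, ⟨e⟩⟩ := JoinTree.exists_sorted_iso_of_isTree hT
  have ht : t.size = 10 := by
    rw [← JoinTree.card_vert, ← Nat.card_congr e.toEquiv, Nat.card_eq_fintype_card, h10]
  have hext : Nonempty (T ≃g starGraph 0 [0, 0, 0, 1, 1, 1]) → dissocNum T = 556 := fun ⟨f⟩ =>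
    (dissocNum_congr f).trans dissocNum_starGraph_extremal
  obtain h | ⟨⟨f⟩⟩ | ⟨⟨f⟩⟩ := ht₀.total_le_or_nonempty_iso ht
  · have hle : dissocNum T ≤ 555 := by rwa [dissocNum_congr e, JoinTree.dissocNum_graph]
    exact ⟨by lia, fun h => by lia, hext⟩
  · obtain ⟨g⟩ := JoinTree.nonempty_iso_extremal
    have hT : Nonempty (T ≃g starGraph 0 [0, 0, 0, 1, 1, 1]) := ⟨(e.trans f).trans g⟩
    exact ⟨(hext hT).le, fun _ => hT, hext⟩
  · obtain ⟨g⟩ := JoinTree.nonempty_iso_exceptional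
    exact absurd ⟨(e.trans f).trans g⟩ hnot
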